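/- Let u be a finite binary word starting with digit 0, v a finite binary word starting with digit 1, a ∈ {0,1}^ℕ starting with digit 0, b ∈ {0,1}^ℕ starting with digit 1, and q₀,q₁ > 1. Then dim_H π_{q₀,q₁}(Ω_{u^∞,b}) = dim_H π_{q₀,q₁}(Ω_{ub,b}) and dim_H π_{q₀,q₁}(Ω_{a,v^∞}) = dim_H π_{q₀,q₁}(Ω_{a,va}), where u^∞, v^∞ are the periodic sequences with periods u, v and ub, va denote concatenations. Consequently h(Ω_{u^∞,b}) = h(Ω_{ub,b}) and h(Ω_{a,v^∞}) = h(Ω_{a,va}). -/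

import Mathlib

open Filter Topology

/-- The base corresponding to a digit: `q0` for digit `0` (`false`), `q1` for digit `1` (`true`). -/
noncomputable def qb (q0 q1 : ℝ) (d : Bool) : ℝ := if d then q1 else q0

/-- `piE q0 q1 i = Σ_{k=1}^∞ i_k / (q_{i_1} ⋯ q_{i_k})`, with 0-based indexing. -/
noncomputable def piE (q0 q1 : ℝ) (i : ℕ → Bool) : ℝ :=
  ∑' k : ℕ, (if i k then (1 : ℝ) else 0) / ∏ j ∈ Finset.range (k + 1), qb q0 q1 (i j)

/-- Strict lexicographic order `≺` on binary sequences. -/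
def lexLt (u v : ℕ → Bool) : Prop := ∃ n : ℕ, (∀ m, m < n → u m = v m) ∧ u n < v n

/-- Non-strict lexicographic order `⪯`. -/
def lexLe (u v : ℕ → Bool) : Prop := lexLt u v ∨ u = v

/-- The tail `i_{n+1} i_{n+2} ⋯` of a sequence (0-based: drop the first `n` entries). -/
def shiftTail (i : ℕ → Bool) (n : ℕ) : ℕ → Bool := fun k => i (n + k)

/-- `Omega a b` : sequences none of whose tails lies in the open lexicographic interval `]a,b[`. -/
def Omega (a b : ℕ → Bool) : Set (ℕ → Bool) :=
  {i | ∀ n : ℕ, ¬ (lexLt a (shiftTail i n) ∧ lexLt (shiftTail i n) b)}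

/-- `(a,b) ∈ W` : `a` starts with digit 0, `b` starts with digit 1, and `a, b ∈ Ω_{a,b}`. -/
def memW (a b : ℕ → Bool) : Prop :=
  a 0 = false ∧ b 0 = true ∧ a ∈ Omega a b ∧ b ∈ Omega a b

/-- The set `L_{a,b,n}` of length-`n` prefixes of elements of `Ω_{a,b}`, as a finset. -/
noncomputable def Lwords (a b : ℕ → Bool) (n : ℕ) : Finset (Fin n → Bool) :=
  Set.Finite.toFinset
    (Set.toFinite {w : Fin n → Bool | ∃ i ∈ Omega a b, ∀ k : Fin n, i k.1 = w k})

/-- Topological entropy `h(Ω_{a,b}) = lim_{n→∞} (1/n) log #L_{a,b,n}`; the limit exists by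
subadditivity, hence it coincides with the `limsup` used here. -/
noncomputable def entropy (a b : ℕ → Bool) : ℝ :=
  Filter.limsup (fun n : ℕ => Real.log ((Lwords a b n).card) / n) Filter.atTop

/-- The periodic sequence `u^∞` with period the finite word `u`. -/
def perSeq (u : List Bool) : ℕ → Bool := fun k => u.getD (k % u.length) false

/-- The concatenation `u x` of a finite word `u` with a sequence `x`. -/
def wordSeq (u : List Bool) (x : ℕ → Bool) : ℕ → Bool :=
  fun k => if k < u.length then u.getD k false else x (k - u.length)


/-- Words of length `n` that are prefixes of elements of `S`. -/
noncomputable def Wd (S : Set (ℕ → Bool)) (n : ℕ) : Finset (Fin n → Bool) :=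
  Set.Finite.toFinset
    (Set.toFinite {w : Fin n → Bool | ∃ i ∈ S, ∀ k : Fin n, i k.1 = w k})

lemma mem_Wd {S : Set (ℕ → Bool)} {n : ℕ} {w : Fin n → Bool} :
    w ∈ Wd S n ↔ ∃ i ∈ S, ∀ k : Fin n, i k.1 = w k := by
  simp [Wd]

/-- Sequences avoiding `G` for the first `k` tails. -/
def Yk (G : Set (ℕ → Bool)) (k : ℕ) : Set (ℕ → Bool) :=
  {i | ∀ n < k, shiftTail i n ∉ G}

/-- Sequences all of whose tails avoid `G`. -/
def Yinf (G : Set (ℕ → Bool)) : Set (ℕ → Bool) :=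
  {i | ∀ n, shiftTail i n ∉ G}

lemma shiftTail_shiftTail (i : ℕ → Bool) (m n : ℕ) :
    shiftTail (shiftTail i m) n = shiftTail i (m + n) := by
  funext k; simp [shiftTail, add_assoc]

lemma continuous_shiftTail (n : ℕ) : Continuous (fun i : ℕ → Bool => shiftTail i n) := by
  unfold shiftTail; fun_prop

lemma isClosed_Yk {G : Set (ℕ → Bool)} (hG : IsOpen G) (k : ℕ) : IsClosed (Yk G k) := by
  have : Yk G k = ⋂ n, ⋂ (_ : n < k), (fun i : ℕ → Bool => shiftTail i n) ⁻¹' Gᶜ := by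
    ext i; simp [Yk]
  rw [this]
  exact isClosed_iInter fun n => isClosed_iInter fun _ =>
    hG.isClosed_compl.preimage (continuous_shiftTail n)

lemma isOpen_cylinder (x : ℕ → Bool) (n : ℕ) : IsOpen {y : ℕ → Bool | ∀ m < n, y m = x m} := by
  have : {y : ℕ → Bool | ∀ m < n, y m = x m}
      = ⋂ m ∈ Set.Iio n, (fun y : ℕ → Bool => y m) ⁻¹' {x m} := by
    ext; simp
  rw [this]
  exact (Set.finite_Iio n).isOpen_biInter fun m _ =>
    (isOpen_discrete _).preimage (continuous_apply m)

lemma isOpen_lexLt_left (a : ℕ → Bool) : IsOpen {x | lexLt a x} := by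
  rw [isOpen_iff_forall_mem_open]
  rintro x ⟨n, h1, h2⟩
  refine ⟨_, ?_, isOpen_cylinder x (n + 1), fun m _ => rfl⟩
  intro y hy
  refine ⟨n, fun m hm => (h1 m hm).trans (hy m (by omega)).symm, ?_⟩
  rw [hy n (by omega)]; exact h2

lemma isOpen_lexLt_right (b : ℕ → Bool) : IsOpen {x | lexLt x b} := by
  rw [isOpen_iff_forall_mem_open]
  rintro x ⟨n, h1, h2⟩
  refine ⟨_, ?_, isOpen_cylinder x (n + 1), fun m _ => rfl⟩
  intro y hy
  refine ⟨n, fun m hm => (hy m (by omega)).trans (h1 m hm), ?_⟩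
  rw [hy n (by omega)]; exact h2

lemma isOpen_gap (a b : ℕ → Bool) : IsOpen {x | lexLt a x ∧ lexLt x b} :=
  (isOpen_lexLt_left a).inter (isOpen_lexLt_right b)

lemma compactness {G : Set (ℕ → Bool)} (hG : IsOpen G) (N : ℕ) :
    ∃ k, ∀ x ∈ Yk G k, ∃ y ∈ Yinf G, ∀ j < N, x j = y j := by
  set C : Set (ℕ → Bool) := {x | ¬ ∃ y ∈ Yinf G, ∀ j < N, x j = y j} with hC
  have hCc : IsClosed C := by
    have : C = (⋃ y ∈ Yinf G, {x : ℕ → Bool | ∀ m < N, x m = y m})ᶜ := by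
      ext x; simp [hC]
    rw [this]
    exact (isOpen_biUnion fun y _ => isOpen_cylinder y N).isClosed_compl
  have hdir : Directed (· ⊇ ·) (Yk G) := by
    refine directed_of_isDirected_le ?_
    intro m n hmn x hx j hj
    exact hx j (by omega)
  have hemp : C ∩ ⋂ k, Yk G k = ∅ := by
    ext x
    simp only [Set.mem_inter_iff, Set.mem_iInter, Set.mem_empty_iff_false, iff_false, not_and]
    intro hx h
    exact hx ⟨x, fun n => h (n + 1) n (by omega), fun _ _ => rfl⟩
  obtain ⟨k, hk⟩ := hCc.isCompact.elim_directed_family_closed (Yk G)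
    (isClosed_Yk hG) hemp hdir
  refine ⟨k, fun x hx => ?_⟩
  by_contra hcon
  have : x ∈ C ∩ Yk G k := ⟨hcon, hx⟩
  rw [hk] at this
  exact this

lemma card_Wd_le (S : Set (ℕ → Bool)) (n : ℕ) : (Wd S n).card ≤ 2 ^ n := by
  refine (Finset.card_le_univ _).trans ?_
  simp

lemma card_Yk_bound {G : Set (ℕ → Bool)} (N : ℕ) (hN : 0 < N) (k : ℕ)
    (hk : ∀ x ∈ Yk G k, ∃ y ∈ Yinf G, ∀ j < N, x j = y j) (n : ℕ) :
    (Wd (Yk G n) n).card ≤ 2 ^ (k + N) * (max (Wd (Yinf G) N).card 1) ^ (n / N) := by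
  induction n using Nat.strong_induction_on with
  | _ n ih =>
  have hK : 1 ≤ max (Wd (Yinf G) N).card 1 := le_max_right _ _
  by_cases hn : n < k + N
  · calc (Wd (Yk G n) n).card ≤ 2 ^ n := card_Wd_le _ _
      _ ≤ 2 ^ (k + N) := Nat.pow_le_pow_right (by norm_num) hn.le
      _ ≤ _ := Nat.le_mul_of_pos_right _ (Nat.pow_pos hK)
  · push Not at hn
    have h1 : (Wd (Yk G n) n).card
        ≤ (Wd (Yinf G) N ×ˢ Wd (Yk G (n - N)) (n - N)).card := by
      apply Finset.card_le_card_of_injOn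
        (fun w => (fun j : Fin N => w ⟨j.1, by omega⟩,
          fun j : Fin (n - N) => w ⟨N + j.1, by omega⟩))
      · intro w hw
        obtain ⟨i, hi, hiw⟩ := mem_Wd.1 (Finset.mem_coe.1 hw)
        simp only [Finset.coe_product, Set.mem_prod, Finset.mem_coe]
        constructor
        · obtain ⟨y, hy, hxy⟩ := hk i (fun m hm => hi m (by omega))
          exact mem_Wd.2 ⟨y, hy, fun j => by rw [← hxy j j.2]; exact hiw ⟨j.1, by omega⟩⟩
        · refine mem_Wd.2 ⟨shiftTail i N, fun m hm => ?_, fun j => hiw ⟨N + j.1, by omega⟩⟩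
          rw [shiftTail_shiftTail]
          exact hi _ (by omega)
      · intro w _ w' _ h
        simp only [Prod.mk.injEq] at h
        funext j
        by_cases hj : j.1 < N
        · exact congrFun h.1 ⟨j.1, hj⟩
        · have := congrFun h.2 ⟨j.1 - N, by omega⟩
          have e : (⟨N + (j.1 - N), by omega⟩ : Fin n) = j := by ext; simp; omega
          simpa [e] using this
    have hdiv : n / N = (n - N) / N + 1 := by
      rw [Nat.div_eq n N, if_pos ⟨hN, by omega⟩]
    calc (Wd (Yk G n) n).card
        ≤ (Wd (Yinf G) N).card * (Wd (Yk G (n - N)) (n - N)).card := by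
          rw [← Finset.card_product]; exact h1
      _ ≤ max (Wd (Yinf G) N).card 1 *
          (2 ^ (k + N) * (max (Wd (Yinf G) N).card 1) ^ ((n - N) / N)) :=
          Nat.mul_le_mul (le_max_left _ _) (ih _ (by omega))
      _ = _ := by rw [hdiv, pow_succ]; ring

lemma card_X_bound {G X : Set (ℕ → Bool)} (T : ℕ → ℕ → Bool)
    (hT : ∀ n k, n ≤ k → ∀ j < n, T k j = T n j)
    (hX : ∀ i ∈ X, ∀ n, shiftTail i n ∈ G → ∃ k, shiftTail i n = T k)
    (n B : ℕ) (hB : ∀ m ≤ n, (Wd (Yk G m) m).card ≤ B) :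
    (Wd X n).card ≤ (n + 1) * (n + 1) * B := by
  let f : (p : ℕ × ℕ) → (Fin p.1 → Bool) → (Fin n → Bool) := fun p w j =>
    if h : j.1 < p.1 then w ⟨j.1, h⟩ else T p.2 (j.1 - p.1)
  have hsub : Wd X n ⊆ (Finset.range (n + 1) ×ˢ Finset.range (n + 1)).biUnion
      (fun p => (Wd (Yk G p.1) p.1).image (f p)) := by
    intro w hw
    obtain ⟨i, hi, hiw⟩ := mem_Wd.1 hw
    rw [Finset.mem_biUnion]
    by_cases hy : i ∈ Yk G n
    · refine ⟨(n, 0), by simp, Finset.mem_image.2 ⟨w, mem_Wd.2 ⟨i, hy, hiw⟩, ?_⟩⟩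
      funext j
      simp [f]
    · have hex : ∃ m, m < n ∧ shiftTail i m ∈ G := by
        simpa [Yk] using hy
      classical
      obtain ⟨hmn, hmG⟩ := Nat.find_spec hex
      have hmin := fun m => Nat.find_min (H := hex) (m := m)
      set m := Nat.find hex with hm
      obtain ⟨k, hk⟩ := hX i hi m hmG
      refine ⟨(m, min k n), by simp; omega, Finset.mem_image.2
        ⟨fun j => i j.1, mem_Wd.2 ⟨i, ?_, fun _ => rfl⟩, ?_⟩⟩
      · intro j hj hjG
        exact hmin j hj ⟨by omega, hjG⟩
      · funext j
        have hj := j.2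
        simp only [f]
        split_ifs with h
        · exact hiw j
        · have h1 : T (min k n) (j.1 - m) = T k (j.1 - m) := by
            rcases le_total k n with h' | h'
            · rw [min_eq_left h']
            · rw [min_eq_right h']
              exact (hT n k h' _ (by omega)).symm
          rw [h1, ← hk, ← hiw j]
          simp only [shiftTail]
          congr 1; omega
  refine (Finset.card_le_card hsub).trans ?_
  refine (Finset.card_biUnion_le_card_mul _ _ B ?_).trans ?_
  · intro p hp
    simp at hp
    exact Finset.card_image_le.trans (hB _ (by omega))
  · simp

lemma log_card_bounds (S : Set (ℕ → Bool)) (n : ℕ) :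
    0 ≤ Real.log (Wd S n).card / n ∧ Real.log (Wd S n).card / n ≤ Real.log 2 := by
  have h0 : 0 ≤ Real.log (Wd S n).card := Real.log_natCast_nonneg _
  refine ⟨by positivity, ?_⟩
  apply div_le_of_le_mul₀ (by positivity) (Real.log_nonneg (by norm_num))
  rcases Nat.eq_zero_or_pos (Wd S n).card with h | h
  · rw [h]; simp; positivity
  · calc Real.log (Wd S n).card ≤ Real.log ((2:ℝ) ^ n) := by
          apply Real.log_le_log (by exact_mod_cast h)
          exact_mod_cast card_Wd_le S n
      _ = _ := by rw [Real.log_pow]; ring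

lemma entropy_bound {G X : Set (ℕ → Bool)} (hG : IsOpen G) (T : ℕ → ℕ → Bool)
    (hT : ∀ n k, n ≤ k → ∀ j < n, T k j = T n j)
    (hX : ∀ i ∈ X, ∀ n, shiftTail i n ∈ G → ∃ k, shiftTail i n = T k)
    (N : ℕ) (hN : 0 < N) :
    limsup (fun n : ℕ => Real.log (Wd X n).card / n) atTop ≤ Real.log (Wd (Yinf G) N).card / N := by
  obtain ⟨k, hk⟩ := compactness hG N
  set K := max (Wd (Yinf G) N).card 1 with hKdef
  have hK : 1 ≤ K := le_max_right _ _
  have hlogK : Real.log K = Real.log (Wd (Yinf G) N).card := by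
    rcases Nat.eq_zero_or_pos (Wd (Yinf G) N).card with h | h
    · simp [hKdef, h]
    · rw [hKdef, max_eq_left h]
  have hlogK0 : 0 ≤ Real.log K := Real.log_natCast_nonneg _
  let g : ℕ → ℝ := fun n => 2 * (Real.log (n + 1) / n) + Real.log (2 ^ (k + N)) / n + Real.log K / N
  have hbound : ∀ᶠ n : ℕ in atTop, Real.log (Wd X n).card / n ≤ g n := by
    filter_upwards [eventually_gt_atTop 0] with n hn
    have hn' : (0:ℝ) < n := by exact_mod_cast hn
    have hc : (Wd X n).card ≤ (n + 1) * (n + 1) * (2 ^ (k + N) * K ^ (n / N)) := by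
      apply card_X_bound T hT hX
      intro m hm
      refine (card_Yk_bound N hN k hk m).trans ?_
      exact Nat.mul_le_mul_left _ (Nat.pow_le_pow_right hK (Nat.div_le_div_right hm))
    have hKp : (0:ℝ) < K := by exact_mod_cast hK
    have hlog : Real.log (Wd X n).card ≤ 2 * Real.log (n + 1) + Real.log (2 ^ (k + N))
        + (n / N : ℝ) * Real.log K := by
      have e : Real.log (((n:ℝ) + 1) * (n + 1) * (2 ^ (k + N) * K ^ (n / N)))
          = 2 * Real.log (n + 1) + Real.log (2 ^ (k + N)) + ((n / N : ℕ) : ℝ) * Real.log K := by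
        rw [Real.log_mul (by positivity) (by positivity),
          Real.log_mul (by positivity) (by positivity),
          Real.log_mul (by positivity) (by positivity), Real.log_pow (K : ℝ)]
        ring
      have h2 : ((n / N : ℕ) : ℝ) * Real.log K ≤ (n / N : ℝ) * Real.log K :=
        mul_le_mul_of_nonneg_right Nat.cast_div_le hlogK0
      have h1 : Real.log (Wd X n).card
          ≤ Real.log (((n:ℝ) + 1) * (n + 1) * (2 ^ (k + N) * K ^ (n / N))) := by
        rcases Nat.eq_zero_or_pos (Wd X n).card with h | h
        · rw [h]; simp only [Nat.cast_zero, Real.log_zero]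
          rw [e]
          have : 0 ≤ Real.log ((n:ℝ) + 1) := Real.log_nonneg (by linarith)
          have : 0 ≤ Real.log ((2:ℝ) ^ (k + N)) := Real.log_nonneg (one_le_pow₀ (by norm_num))
          positivity
        · apply Real.log_le_log (by exact_mod_cast h)
          exact_mod_cast hc
      linarith
    calc Real.log (Wd X n).card / n ≤ (2 * Real.log (n + 1) + Real.log (2 ^ (k + N))
        + (n / N : ℝ) * Real.log K) / n := by gcongr
      _ = g n := by simp only [g]; field_simp
  have hg : Tendsto g atTop (𝓝 (Real.log K / N)) := by
    have h1 : Tendsto (fun n : ℕ => Real.log ((n:ℝ) + 1) / n) atTop (𝓝 0) := by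
      have h := Real.tendsto_pow_log_div_mul_add_atTop 1 (-1) 1 one_ne_zero
      have h' := h.comp (tendsto_atTop_add_const_right atTop (1:ℝ) tendsto_natCast_atTop_atTop)
      refine h'.congr fun n => ?_
      simp
    have h2 : Tendsto (fun n : ℕ => Real.log ((2:ℝ) ^ (k + N)) / n) atTop (𝓝 0) :=
      tendsto_const_div_atTop_nhds_zero_nat _
    have := ((h1.const_mul 2).add h2).add_const (Real.log K / N)
    simpa only [mul_zero, add_zero, zero_add] using this
  rw [← hlogK, ← hg.limsup_eq]
  refine limsup_le_limsup hbound ?_ hg.isBoundedUnder_le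
  exact (isBoundedUnder_of ⟨0, fun n => (log_card_bounds X n).1⟩ :
    IsBoundedUnder (· ≥ ·) atTop _).isCoboundedUnder_le

lemma entropy_eq_gen {G X : Set (ℕ → Bool)} (hG : IsOpen G) (T : ℕ → ℕ → Bool)
    (hT : ∀ n k, n ≤ k → ∀ j < n, T k j = T n j)
    (hX : ∀ i ∈ X, ∀ n, shiftTail i n ∈ G → ∃ k, shiftTail i n = T k)
    (hYX : Yinf G ⊆ X) :
    limsup (fun n : ℕ => Real.log (Wd (Yinf G) n).card / n) atTop
      = limsup (fun n : ℕ => Real.log (Wd X n).card / n) atTop := by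
  have hbd : ∀ S : Set (ℕ → Bool), IsBoundedUnder (· ≤ ·) atTop
      (fun n : ℕ => Real.log (Wd S n).card / n) := fun S =>
    isBoundedUnder_of ⟨Real.log 2, fun n => (log_card_bounds S n).2⟩
  have hcb : ∀ S : Set (ℕ → Bool), IsCoboundedUnder (· ≤ ·) atTop
      (fun n : ℕ => Real.log (Wd S n).card / n) := fun S =>
    (isBoundedUnder_of ⟨0, fun n => (log_card_bounds S n).1⟩ :
      IsBoundedUnder (· ≥ ·) atTop _).isCoboundedUnder_le
  apply le_antisymm
  · refine limsup_le_limsup (Eventually.of_forall fun n => ?_) (hcb _) (hbd _)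
    have hle : (Wd (Yinf G) n).card ≤ (Wd X n).card := by
      apply Finset.card_le_card
      intro w hw
      obtain ⟨i, hi, h⟩ := mem_Wd.1 hw
      exact mem_Wd.2 ⟨i, hYX hi, h⟩
    show Real.log (Wd (Yinf G) n).card / n ≤ Real.log (Wd X n).card / n
    rcases Nat.eq_zero_or_pos (Wd (Yinf G) n).card with h | h
    · rw [h]; simpa using (log_card_bounds X n).1
    · have h1 : (0:ℝ) < (Wd (Yinf G) n).card := by exact_mod_cast h
      gcongr
  · refine le_limsup_of_frequently_le ?_ (hbd _)
    apply Eventually.frequently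
    filter_upwards [eventually_gt_atTop 0] with N hN
    exact entropy_bound hG T hT hX N hN

lemma dim_eq_gen {G X : Set (ℕ → Bool)} (T : ℕ → ℕ → Bool)
    (hX : ∀ i ∈ X, ∀ n, shiftTail i n ∈ G → ∃ k, shiftTail i n = T k)
    (hYX : Yinf G ⊆ X) (f : (ℕ → Bool) → ℝ) :
    dimH (f '' Yinf G) = dimH (f '' X) := by
  have hc : (X \ Yinf G).Countable := by
    refine (Set.countable_range (fun p : List Bool × ℕ => wordSeq p.1 (T p.2))).mono ?_
    rintro i ⟨hi, hiY⟩
    have : ∃ n, shiftTail i n ∈ G := by simpa [Yinf] using hiY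
    obtain ⟨m, hm⟩ := this
    obtain ⟨k, hk⟩ := hX i hi m hm
    refine ⟨(List.ofFn (fun j : Fin m => i j), k), ?_⟩
    funext j
    simp only [wordSeq, List.length_ofFn, ← hk]
    split_ifs with h
    · simp [h]
    · simp only [shiftTail]; congr 1; omega
  have hU : X = Yinf G ∪ (X \ Yinf G) := (Set.union_sdiff_cancel hYX).symm
  rw [hU, Set.image_union, dimH_union, (hc.image f).dimH_zero]
  simp

/-! ### Lexicographic structure -/

lemma lexLt_trans {x y z : ℕ → Bool} (h1 : lexLt x y) (h2 : lexLt y z) : lexLt x z := by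
  obtain ⟨n, hn, hn'⟩ := h1
  obtain ⟨m, hm, hm'⟩ := h2
  rcases lt_trichotomy n m with h | h | h
  · exact ⟨n, fun k hk => (hn k hk).trans (hm k (by omega)), by rw [← hm n h]; exact hn'⟩
  · subst h
    exact ⟨n, fun k hk => (hn k hk).trans (hm k hk), hn'.trans hm'⟩
  · exact ⟨m, fun k hk => (hn k (by omega)).trans (hm k hk), by rw [hn m h]; exact hm'⟩

lemma lexLt_irrefl (x : ℕ → Bool) : ¬ lexLt x x := fun ⟨_, _, h⟩ => lt_irrefl _ h

lemma lexLt_total {x y : ℕ → Bool} (h : x ≠ y) : lexLt x y ∨ lexLt y x := by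
  classical
  have hex : ∃ n, x n ≠ y n := Function.ne_iff.1 h
  have hmin : ∀ m < Nat.find hex, x m = y m := fun m hm => by
    simpa using Nat.find_min hex hm
  rcases lt_or_gt_of_ne (Nat.find_spec hex) with h' | h'
  · exact Or.inl ⟨_, hmin, h'⟩
  · exact Or.inr ⟨_, fun m hm => (hmin m hm).symm, h'⟩

lemma wordSeq_add (u : List Bool) (x : ℕ → Bool) (k : ℕ) : wordSeq u x (u.length + k) = x k := by
  simp [wordSeq]

lemma wordSeq_of_lt (u : List Bool) (x y : ℕ → Bool) (k : ℕ) (hk : k < u.length) :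
    wordSeq u x k = wordSeq u y k := by
  simp [wordSeq, hk]

lemma lexLt_wordSeq (u : List Bool) (x y : ℕ → Bool) :
    lexLt (wordSeq u x) (wordSeq u y) ↔ lexLt x y := by
  constructor
  · rintro ⟨n, h1, h2⟩
    have hn : u.length ≤ n := by
      by_contra hcon
      rw [wordSeq_of_lt u x y n (by omega)] at h2
      exact lt_irrefl _ h2
    obtain ⟨m, rfl⟩ := Nat.exists_eq_add_of_le hn
    refine ⟨m, fun k hk => ?_, by simpa [wordSeq_add] using h2⟩
    simpa [wordSeq_add] using h1 (u.length + k) (by omega)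
  · rintro ⟨n, h1, h2⟩
    refine ⟨u.length + n, fun k hk => ?_, by simpa [wordSeq_add] using h2⟩
    by_cases h : k < u.length
    · exact wordSeq_of_lt _ _ _ _ h
    · obtain ⟨m, rfl⟩ := Nat.exists_eq_add_of_le (not_lt.1 h)
      simpa [wordSeq_add] using h1 m (by omega)

lemma squeeze {u : List Bool} {x y t : ℕ → Bool} (h1 : lexLt (wordSeq u x) t)
    (h2 : lexLt t (wordSeq u y)) : t = wordSeq u (shiftTail t u.length) := by
  obtain ⟨n, hn, hn'⟩ := h1
  obtain ⟨m, hm, hm'⟩ := h2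
  have hlen : u.length ≤ n := by
    by_contra hcon
    push Not at hcon
    rcases lt_trichotomy n m with h | h | h
    · rw [hm n h, wordSeq_of_lt u x y n hcon] at hn'
      exact lt_irrefl _ hn'
    · subst h
      rw [wordSeq_of_lt u x y n hcon] at hn'
      exact lt_irrefl _ (hn'.trans hm')
    · rw [← hn m h, wordSeq_of_lt u x y m (by omega)] at hm'
      exact lt_irrefl _ hm'
  funext k
  by_cases h : k < u.length
  · rw [← hn k (by omega)]; exact wordSeq_of_lt _ _ _ _ h
  · obtain ⟨j, rfl⟩ := Nat.exists_eq_add_of_le (not_lt.1 h)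
    simp [wordSeq_add, shiftTail]

lemma perSeq_eq (u : List Bool) : perSeq u = wordSeq u (perSeq u) := by
  funext k
  by_cases h : k < u.length
  · simp [perSeq, wordSeq, h, Nat.mod_eq_of_lt h]
  · obtain ⟨j, rfl⟩ := Nat.exists_eq_add_of_le (not_lt.1 h)
    rw [wordSeq_add]
    simp [perSeq]

/-- The sequences `u^k b`. -/
def Tseq (u : List Bool) (b : ℕ → Bool) : ℕ → ℕ → Bool
  | 0 => b
  | k + 1 => wordSeq u (Tseq u b k)

lemma Tseq_per {u : List Bool} (hu : 0 < u.length) (b : ℕ → Bool) (k : ℕ) :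
    ∀ j < k, Tseq u b k j = perSeq u j := by
  induction k with
  | zero => intro j hj; omega
  | succ k ih =>
    intro j hj
    rw [perSeq_eq, Tseq]
    by_cases h : j < u.length
    · exact wordSeq_of_lt _ _ _ _ h
    · obtain ⟨j, rfl⟩ := Nat.exists_eq_add_of_le (not_lt.1 h)
      rw [wordSeq_add, wordSeq_add]
      exact ih j (by omega)

lemma Tseq_stable {u : List Bool} (hu : 0 < u.length) (b : ℕ → Bool) (n k : ℕ) (hnk : n ≤ k) :
    ∀ j < n, Tseq u b k j = Tseq u b n j := fun j hj => by
  rw [Tseq_per hu b k j (by omega), Tseq_per hu b n j hj]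

lemma struct_step {u : List Bool} {b i : ℕ → Bool} (hi : i ∈ Omega (wordSeq u b) b)
    (hu : 0 < u.length) (k : ℕ) : ∀ n, lexLt (perSeq u) (shiftTail i n) → lexLt (shiftTail i n) b →
      (∃ k, shiftTail i n = Tseq u b k) ∨ ∀ j < k, shiftTail i n j = perSeq u j := by
  induction k with
  | zero => intro n _ _; right; intro j hj; omega
  | succ k ih =>
    intro n h1 h2
    by_cases heq : shiftTail i n = wordSeq u b
    · exact Or.inl ⟨1, heq⟩
    have hlt : lexLt (shiftTail i n) (wordSeq u b) := by
      rcases lexLt_total heq with h | h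
      · exact h
      · exact absurd ⟨h, h2⟩ (hi n)
    rw [perSeq_eq] at h1
    have hs := squeeze h1 hlt
    rw [hs, lexLt_wordSeq, shiftTail_shiftTail] at h1 hlt
    rw [shiftTail_shiftTail] at hs
    rcases ih _ h1 hlt with ⟨k', hk'⟩ | h
    · left; exact ⟨k' + 1, by rw [hs, hk', Tseq]⟩
    · right
      intro j hj
      rw [hs, perSeq_eq]
      by_cases hj' : j < u.length
      · exact wordSeq_of_lt _ _ _ _ hj'
      · obtain ⟨j, rfl⟩ := Nat.exists_eq_add_of_le (not_lt.1 hj')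
        rw [wordSeq_add, wordSeq_add]
        exact h j (by omega)

lemma struct_main {u : List Bool} {b i : ℕ → Bool} (hi : i ∈ Omega (wordSeq u b) b)
    (hu : 0 < u.length) (n : ℕ) (h1 : lexLt (perSeq u) (shiftTail i n))
    (h2 : lexLt (shiftTail i n) b) : ∃ k, shiftTail i n = Tseq u b k := by
  by_contra hcon
  have : shiftTail i n = perSeq u := by
    funext j
    exact ((struct_step hi hu (j + 1) n h1 h2).resolve_left hcon) j (by omega)
  rw [this] at h1
  exact lexLt_irrefl _ h1

lemma perSeq_lt {u : List Bool} {b : ℕ → Bool} (hu : u.head? = some false) (hb : b 0 = true) :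
    lexLt (perSeq u) (wordSeq u b) := by
  rw [perSeq_eq, lexLt_wordSeq]
  refine ⟨0, fun m hm => by omega, ?_⟩
  cases u with
  | nil => simp at hu
  | cons c u => simp at hu; simp [perSeq, hu, hb]

/-- Digitwise complement. -/
def flipS (x : ℕ → Bool) : ℕ → Bool := fun k => !(x k)

lemma flipS_flipS (x : ℕ → Bool) : flipS (flipS x) = x := by funext k; simp [flipS]

lemma lexLt_flip (x y : ℕ → Bool) : lexLt (flipS x) (flipS y) ↔ lexLt y x := by
  have key : ∀ p q : Bool, (!p) < (!q) ↔ q < p := by decide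
  simp only [lexLt, flipS, key, Bool.not_inj_iff]
  constructor <;> rintro ⟨n, h, h'⟩ <;> exact ⟨n, fun m hm => (h m hm).symm, h'⟩

lemma flip_wordSeq (v : List Bool) (a : ℕ → Bool) :
    flipS (wordSeq v a) = wordSeq (v.map not) (flipS a) := by
  funext k
  by_cases h : k < v.length <;> simp [flipS, wordSeq, h]

lemma flip_perSeq (v : List Bool) (hv : 0 < v.length) :
    flipS (perSeq v) = perSeq (v.map not) := by
  funext k
  have := Nat.mod_lt k hv
  simp [flipS, perSeq, this]

lemma flip_shiftTail (x : ℕ → Bool) (n : ℕ) :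
    flipS (shiftTail x n) = shiftTail (flipS x) n := rfl

lemma struct_dual {v : List Bool} {a i : ℕ → Bool} (hi : i ∈ Omega a (wordSeq v a))
    (hv : 0 < v.length) (n : ℕ) (h1 : lexLt a (shiftTail i n))
    (h2 : lexLt (shiftTail i n) (perSeq v)) : ∃ k, shiftTail i n = Tseq v a k := by
  have hi' : flipS i ∈ Omega (wordSeq (v.map not) (flipS a)) (flipS a) := by
    intro m
    rw [← flip_wordSeq, ← flip_shiftTail, lexLt_flip, lexLt_flip]
    exact fun h => hi m ⟨h.2, h.1⟩
  have hT : ∀ k, Tseq (v.map not) (flipS a) k = flipS (Tseq v a k) := by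
    intro k
    induction k with
    | zero => rfl
    | succ k ih => rw [Tseq, Tseq, ih, flip_wordSeq]
  obtain ⟨k, hk⟩ := struct_main hi' (by simpa using hv) n
    (by rw [← flip_perSeq v hv, ← flip_shiftTail, lexLt_flip]; exact h2)
    (by rw [← flip_shiftTail, lexLt_flip]; exact h1)
  refine ⟨k, ?_⟩
  rw [hT, ← flip_shiftTail] at hk
  rw [← flipS_flipS (shiftTail i n), hk, flipS_flipS]

lemma perSeq_gt {v : List Bool} {a : ℕ → Bool} (hv : v.head? = some true) (ha : a 0 = false) :
    lexLt (wordSeq v a) (perSeq v) := by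
  rw [perSeq_eq, lexLt_wordSeq]
  refine ⟨0, fun m hm => by omega, ?_⟩
  cases v with
  | nil => simp at hv
  | cons c v => simp at hv; simp [perSeq, hv, ha]

lemma Omega_eq (a b : ℕ → Bool) : Omega a b = Yinf {x | lexLt a x ∧ lexLt x b} := rfl

lemma entropy_eq_Wd (a b : ℕ → Bool) : entropy a b
    = limsup (fun n : ℕ => Real.log (Wd (Omega a b) n).card / n) atTop := rfl

/-- Theorem 5, second part: for all finite words `u ∈ 0{0,1}^*`, `v ∈ 1{0,1}^*`, sequences
`a ∈ 0{0,1}^ℕ`, `b ∈ 1{0,1}^ℕ` and `q₀,q₁ > 1`,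
`dim_H π_{q₀,q₁}(Ω_{u^∞,b}) = dim_H π_{q₀,q₁}(Ω_{ub,b})` and
`dim_H π_{q₀,q₁}(Ω_{a,v^∞}) = dim_H π_{q₀,q₁}(Ω_{a,va})`, hence
`h(Ω_{u^∞,b}) = h(Ω_{ub,b})` and `h(Ω_{a,v^∞}) = h(Ω_{a,va})`. -/
theorem stmt10 (u v : List Bool) (a b : ℕ → Bool)
    (hu : u.head? = some false) (hv : v.head? = some true)
    (ha : a 0 = false) (hb : b 0 = true)
    (q0 q1 : ℝ) (hq0 : 1 < q0) (hq1 : 1 < q1) :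
    dimH (piE q0 q1 '' Omega (perSeq u) b) = dimH (piE q0 q1 '' Omega (wordSeq u b) b) ∧
    dimH (piE q0 q1 '' Omega a (perSeq v)) = dimH (piE q0 q1 '' Omega a (wordSeq v a)) ∧
    entropy (perSeq u) b = entropy (wordSeq u b) b ∧
    entropy a (perSeq v) = entropy a (wordSeq v a) := by
  have hul : 0 < u.length := by
    cases u with
    | nil => simp at hu
    | cons c u => simp
  have hvl : 0 < v.length := by
    cases v with
    | nil => simp at hv
    | cons c v => simp
  have hX1 : ∀ i ∈ Omega (wordSeq u b) b, ∀ n,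
      shiftTail i n ∈ {x | lexLt (perSeq u) x ∧ lexLt x b} →
      ∃ k, shiftTail i n = Tseq u b k :=
    fun i hi n h => struct_main hi hul n h.1 h.2
  have hX2 : ∀ i ∈ Omega a (wordSeq v a), ∀ n,
      shiftTail i n ∈ {x | lexLt a x ∧ lexLt x (perSeq v)} →
      ∃ k, shiftTail i n = Tseq v a k :=
    fun i hi n h => struct_dual hi hvl n h.1 h.2
  have hs1 : Yinf {x | lexLt (perSeq u) x ∧ lexLt x b} ⊆ Omega (wordSeq u b) b :=
    fun i hi n h => hi n ⟨lexLt_trans (perSeq_lt hu hb) h.1, h.2⟩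
  have hs2 : Yinf {x | lexLt a x ∧ lexLt x (perSeq v)} ⊆ Omega a (wordSeq v a) :=
    fun i hi n h => hi n ⟨h.1, lexLt_trans h.2 (perSeq_gt hv ha)⟩
  refine ⟨?_, ?_, ?_, ?_⟩
  · rw [Omega_eq (perSeq u) b]
    exact dim_eq_gen _ hX1 hs1 _
  · rw [Omega_eq a (perSeq v)]
    exact dim_eq_gen _ hX2 hs2 _
  · rw [entropy_eq_Wd, entropy_eq_Wd, Omega_eq (perSeq u) b]
    exact entropy_eq_gen (isOpen_gap _ _) _ (Tseq_stable hul b) hX1 hs1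
  · rw [entropy_eq_Wd, entropy_eq_Wd, Omega_eq a (perSeq v)]
    exact entropy_eq_gen (isOpen_gap _ _) _ (Tseq_stable hvl a) hX2 hs2
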